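/- Let G be a reductive group over a field k acting on an irreducible rational representation V with open orbit U = Gw and reductive smooth stabilizer G_w, and let Δ be a relative invariant polynomial with V^ss = {x ∈ V : Δ(x) ≠ 0}. Then for k separably closed, any two points of V^ss(k) lie in the same G(k)-orbit. -/

import Mathlib

/-!
STATEMENT 16: Let `G = Spec R` be a reductive group over a separably closed field `k`
acting on an irreducible rational representation `V = kⁿ` via the coaction `ρ`, with open
orbit `U = Gw` and reductive smooth stabilizer `G_w`, and let `Δ` be a relative invariant
polynomial (`Δ(gx) = χ(g)Δ(x)`, i.e. `coactPoly ρ Δ = Δ ⊗ χ`) with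
`V^ss = {x : Δ(x) ≠ 0}`; by regularity `V \ U` is the zero set of `Δ`, so `V^ss = U`.
Then any two points of `V^ss(k)` lie in the same `G(k)`-orbit.
-/

open TensorProduct AlgebraicGeometry CategoryTheory TopologicalSpace

section Framework

variable {k : Type} [Field k] {R : Type} [CommRing R] [HopfAlgebra k R]

/-- `ρ : V →ₗ V ⊗ R` is a (right) comodule structure over the Hopf algebra `R`, i.e. a
rational representation of the affine group scheme `G = Spec R` on `V`. -/
def IsCoaction {V : Type} [AddCommGroup V] [Module k V] (ρ : V →ₗ[k] V ⊗[k] R) : Prop :=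
  (∀ v, (TensorProduct.rid k V)
      ((TensorProduct.map LinearMap.id (Coalgebra.counit (R := k) (A := R))) (ρ v)) = v) ∧
  (∀ v, (TensorProduct.assoc k V R R)
      ((TensorProduct.map ρ (LinearMap.id : R →ₗ[k] R)) (ρ v)) =
    (TensorProduct.map LinearMap.id (Coalgebra.comul (R := k) (A := R))) (ρ v))

variable {n : ℕ}

/-- The matrix coefficient: the regular function `g ↦ (g • v)_i` on `G = Spec R`. -/
noncomputable def matCoef (ρ : (Fin n → k) →ₗ[k] (Fin n → k) ⊗[k] R)
    (v : Fin n → k) (i : Fin n) : R :=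
  (TensorProduct.lid k R) ((TensorProduct.map (LinearMap.proj i) LinearMap.id) (ρ v))

/-- The comorphism `k[V] → R` of the orbit map `G → V`, `g ↦ g • w`. -/
noncomputable def orbitHom (ρ : (Fin n → k) →ₗ[k] (Fin n → k) ⊗[k] R) (w : Fin n → k) :
    MvPolynomial (Fin n) k →ₐ[k] R :=
  MvPolynomial.aeval (fun i => matCoef ρ w i)

/-- The orbit map `G = Spec R ⟶ V = Spec k[x₁,…,xₙ]` of the point `w`; its set-theoretic
image is the orbit `Gw`. -/
noncomputable def orbitMap (ρ : (Fin n → k) →ₗ[k] (Fin n → k) ⊗[k] R) (w : Fin n → k) :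
    Spec (CommRingCat.of R) ⟶ Spec (CommRingCat.of (MvPolynomial (Fin n) k)) :=
  Spec.map (CommRingCat.ofHom (orbitHom ρ w).toRingHom)

/-- The ideal of the scheme-theoretic stabilizer `G_w` of `w` in `G = Spec R`: it is
generated by the functions `g ↦ (g • w)_i − w_i`, so `G_w = Spec (R ⧸ stabIdeal ρ w)`. -/
noncomputable def stabIdeal (ρ : (Fin n → k) →ₗ[k] (Fin n → k) ⊗[k] R) (w : Fin n → k) :
    Ideal R :=
  Ideal.span {x | ∃ i, x = matCoef ρ w i - algebraMap k R (w i)}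

/-- The action of a `k`-rational point `g : R →ₐ[k] k` of `G` on `V = kⁿ`. -/
noncomputable def ptAct (ρ : (Fin n → k) →ₗ[k] (Fin n → k) ⊗[k] R)
    (g : R →ₐ[k] k) (v : Fin n → k) : Fin n → k :=
  (TensorProduct.rid k (Fin n → k)) ((TensorProduct.map LinearMap.id g.toLinearMap) (ρ v))

/-- The induced coaction of `R` on the coordinate ring `k[V] = k[x₁,…,xₙ]`, i.e. the
comorphism of the action morphism `V × G → V`. -/
noncomputable def coactPoly (ρ : (Fin n → k) →ₗ[k] (Fin n → k) ⊗[k] R) :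
    MvPolynomial (Fin n) k →ₐ[k] (MvPolynomial (Fin n) k) ⊗[k] R :=
  MvPolynomial.aeval (fun i => ∑ j, (MvPolynomial.X j) ⊗ₜ[k] (matCoef ρ (Pi.single j 1) i))

/-- The `k`-rational point of affine `n`-space corresponding to `x : kⁿ`. -/
noncomputable def ratPoint (x : Fin n → k) :
    Spec (CommRingCat.of (MvPolynomial (Fin n) k)) :=
  ⟨RingHom.ker (MvPolynomial.eval x), RingHom.ker_isPrime _⟩

/-- An affine group scheme `G = Spec R` over `k`, given by a finitely generated
commutative Hopf algebra `R`, is reductive: it is smooth over `k` and geometrically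
reductive in the sense of Mumford–Haboush (for every finite-dimensional rational
representation and every nonzero invariant vector `w` there is a nonconstant homogeneous
invariant polynomial not vanishing at `w`); by Haboush's theorem geometric reductivity is
equivalent to reductivity. -/
def IsReductive (k R : Type) [Field k] [CommRing R] [HopfAlgebra k R] : Prop :=
  Algebra.FiniteType k R ∧ Algebra.Smooth k R ∧
  ∀ (n : ℕ) (ρ : (Fin n → k) →ₗ[k] (Fin n → k) ⊗[k] R), IsCoaction ρ →
    ∀ w : Fin n → k, w ≠ 0 → ρ w = w ⊗ₜ[k] (1 : R) →
      ∃ (f : MvPolynomial (Fin n) k) (d : ℕ), 0 < d ∧ f.IsHomogeneous d ∧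
        coactPoly ρ f = f ⊗ₜ[k] (1 : R) ∧ MvPolynomial.eval w f ≠ 0

/-- `π : R → S` presents `Spec S` as a closed subgroup scheme of `Spec R`: it is a
surjective algebra map compatible with the comultiplications (a Hopf algebra quotient). -/
def IsHopfQuotient {S : Type} [CommRing S] [HopfAlgebra k S] (π : R →ₐ[k] S) : Prop :=
  Function.Surjective π ∧
    ∀ x : R, Coalgebra.comul (R := k) (π x) =
      (TensorProduct.map π.toLinearMap π.toLinearMap) (Coalgebra.comul (R := k) x)

end Framework

section RationalPoints

/-- A nonzero smooth algebra over a separably closed field has a rational point. -/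
theorem nonempty_algHom_of_smooth (k A : Type) [Field k] [IsSepClosed k] [CommRing A]
    [Algebra k A] [Algebra.Smooth k A] [Nontrivial A] : Nonempty (A →ₐ[k] k) := by
  obtain ⟨m, hm⟩ := Ideal.exists_maximal A
  obtain ⟨f, hfm, n, _, _, _⟩ :=
    Algebra.IsSmoothAt.exists_isStandardEtale_mvPolynomial (R := k) (p := m)
  have hf : ¬ IsNilpotent f := fun h => hfm (hm.isPrime.mem_of_pow_mem _
    (h.choose_spec ▸ m.zero_mem))
  have : Nontrivial (Localization.Away f) := by
    by_contra h
    rw [not_nontrivial_iff_subsingleton,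
      IsLocalization.subsingleton_iff (M := Submonoid.powers f)] at h
    obtain ⟨r, hr⟩ := h
    exact hf ⟨r, hr⟩
  have hopen : IsOpen (Set.range
      (PrimeSpectrum.comap (algebraMap (MvPolynomial (Fin n) k) (Localization.Away f)))) :=
    (PrimeSpectrum.isOpenMap_comap_of_hasGoingDown_of_finitePresentation).isOpen_range
  obtain ⟨q₀⟩ : Nonempty (PrimeSpectrum (Localization.Away f)) := inferInstance
  obtain ⟨_, ⟨_, ⟨g, rfl⟩, rfl⟩, hg, hgsub⟩ := PrimeSpectrum.isBasis_basic_opens.exists_subset_of_mem_open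
    (Set.mem_range_self q₀) hopen
  have hg0 : g ≠ 0 := by
    rintro rfl
    simp at hg
  have : Infinite k := by
    by_contra h
    have : Finite k := not_infinite_iff_finite.1 h
    exact h inferInstance
  obtain ⟨a, ha⟩ : ∃ a : Fin n → k, MvPolynomial.eval a g ≠ 0 := by
    by_contra! h
    exact hg0 (MvPolynomial.funext fun a => by simp [h a])
  obtain ⟨q, hq⟩ := hgsub (show (⟨RingHom.ker (MvPolynomial.eval a), RingHom.ker_isPrime _⟩ :
    PrimeSpectrum (MvPolynomial (Fin n) k)) ∈ _ from ha)
  let _ : Algebra (MvPolynomial (Fin n) k) k := (MvPolynomial.eval a).toAlgebra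
  have heval (r : MvPolynomial (Fin n) k) :
      algebraMap (MvPolynomial (Fin n) k) k r = MvPolynomial.eval a r := rfl
  let φ : k →ₐ[MvPolynomial (Fin n) k] Localization.Away f ⧸ q.asIdeal :=
    { algebraMap k (Localization.Away f ⧸ q.asIdeal) with
      commutes' := fun r => by
        have h : MvPolynomial.C (MvPolynomial.eval a r) - r ∈
            Ideal.comap (algebraMap _ (Localization.Away f)) q.asIdeal := by
          have := congrArg PrimeSpectrum.asIdeal hq
          rw [PrimeSpectrum.comap_asIdeal] at this
          rw [this]
          simp [RingHom.mem_ker]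
        rw [Ideal.mem_comap, map_sub, ← Ideal.Quotient.eq] at h
        rw [← MvPolynomial.algebraMap_eq, ← IsScalarTower.algebraMap_apply] at h
        exact h }
  let ψ : k ⊗[MvPolynomial (Fin n) k] Localization.Away f →ₐ[MvPolynomial (Fin n) k]
      Localization.Away f ⧸ q.asIdeal :=
    Algebra.TensorProduct.lift φ (Ideal.Quotient.mkₐ _ q.asIdeal) fun _ _ => .all _ _
  have : Nontrivial (k ⊗[MvPolynomial (Fin n) k] Localization.Away f) := ψ.domain_nontrivial
  obtain ⟨p⟩ : Nonempty (PrimeSpectrum (k ⊗[MvPolynomial (Fin n) k] Localization.Away f)) :=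
    inferInstance
  let e := (Algebra.IsFiniteSplit.algHomEquivPrimeSpectrum k
    (k ⊗[MvPolynomial (Fin n) k] Localization.Away f)).symm p
  let ι := (Algebra.TensorProduct.includeRight :
    Localization.Away f →ₐ[MvPolynomial (Fin n) k] k ⊗[MvPolynomial (Fin n) k] Localization.Away f)
  refine ⟨{ (e.toRingHom.comp ι.toRingHom).comp (algebraMap A (Localization.Away f)) with
    commutes' := fun c => ?_ }⟩
  have h : ι (algebraMap A _ (algebraMap k A c)) = algebraMap k _ c := by
    rw [← IsScalarTower.algebraMap_apply, IsScalarTower.algebraMap_apply k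
      (MvPolynomial (Fin n) k), AlgHom.commutes, IsScalarTower.algebraMap_apply _ k, heval,
      MvPolynomial.algebraMap_eq, MvPolynomial.eval_C]
  change e (ι (algebraMap A _ (algebraMap k A c))) = _
  rw [h, AlgHom.commutes]

end RationalPoints

section Convolution

open WithConv

variable {k R B : Type*} [CommRing k] [CommRing R] [HopfAlgebra k R] [CommRing B] [Algebra k B]

/-- The inverse of a `B`-valued point of an affine group scheme. -/
noncomputable def pointInv (f : WithConv (R →ₐ[k] B)) : WithConv (R →ₐ[k] B) :=
  toConv (f.ofConv.comp (HopfAlgebra.antipodeAlgHom k R))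

theorem pointInv_mul (f : WithConv (R →ₐ[k] B)) : pointInv f * f = 1 := by
  have h := AlgHom.comp_convMul_distrib f.ofConv (toConv (AlgHom.id k R))⁻¹ (toConv (AlgHom.id k R))
  rw [inv_mul_cancel] at h
  apply ofConv_injective
  refine h.symm.trans ?_
  ext; simp [AlgHom.convOne_def]

theorem mul_pointInv (f : WithConv (R →ₐ[k] B)) : f * pointInv f = 1 := by
  have h := AlgHom.comp_convMul_distrib f.ofConv (toConv (AlgHom.id k R)) (toConv (AlgHom.id k R))⁻¹
  rw [mul_inv_cancel] at h
  apply ofConv_injective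
  refine h.symm.trans ?_
  ext; simp [AlgHom.convOne_def]

end Convolution

section Transporter

open WithConv

variable {k : Type} [Field k] {R : Type} [CommRing R] [HopfAlgebra k R] {n : ℕ}
  {ρ : (Fin n → k) →ₗ[k] (Fin n → k) ⊗[k] R}

theorem eq_sum_tmul_matCoef (ρ : (Fin n → k) →ₗ[k] (Fin n → k) ⊗[k] R) (v : Fin n → k) :
    ρ v = ∑ j, Pi.single j 1 ⊗ₜ[k] matCoef ρ v j := by
  unfold matCoef
  induction ρ v using TensorProduct.induction_on with
  | zero => simp
  | add a b ha hb => simp only [map_add, TensorProduct.tmul_add, Finset.sum_add_distrib, ← ha, ← hb]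
  | tmul u r =>
    simp only [TensorProduct.map_tmul, LinearMap.proj_apply, LinearMap.id_apply,
      TensorProduct.lid_tmul, TensorProduct.tmul_smul, TensorProduct.smul_tmul',
      ← TensorProduct.sum_tmul]
    congr 1
    ext i
    simp [Finset.sum_apply, Pi.single_apply]

theorem counit_matCoef (hρ : IsCoaction ρ) (v : Fin n → k) (i : Fin n) :
    Coalgebra.counit (R := k) (matCoef ρ v i) = v i := by
  have h := congrFun (hρ.1 v) i
  rw [eq_sum_tmul_matCoef ρ v] at h
  simpa [Finset.sum_apply, Pi.single_apply] using h

theorem comul_matCoef (hρ : IsCoaction ρ) (v : Fin n → k) (i : Fin n) :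
    Coalgebra.comul (R := k) (matCoef ρ v i) =
      ∑ j, matCoef ρ (Pi.single j 1) i ⊗ₜ[k] matCoef ρ v j := by
  have h := congrArg (fun t => TensorProduct.lid k (R ⊗[k] R)
    (TensorProduct.map (LinearMap.proj i) LinearMap.id t)) (hρ.2 v)
  rw [eq_sum_tmul_matCoef ρ v] at h
  simp only [map_sum, TensorProduct.map_tmul, LinearMap.id_apply, LinearMap.proj_apply,
    TensorProduct.lid_tmul] at h
  simp only [eq_sum_tmul_matCoef ρ (Pi.single _ 1), TensorProduct.sum_tmul, map_sum,
    TensorProduct.assoc_tmul, TensorProduct.map_tmul, LinearMap.id_apply, LinearMap.proj_apply,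
    TensorProduct.lid_tmul] at h
  simpa [Pi.single_apply, ite_smul] using h.symm

/-- The point `f` of `G = Spec R` with values in a `k`-algebra carries `x` to `y`. -/
def Carries {B : Type*} [CommRing B] [Algebra k B] (ρ : (Fin n → k) →ₗ[k] (Fin n → k) ⊗[k] R)
    (x y : Fin n → k) (f : WithConv (R →ₐ[k] B)) : Prop :=
  ∀ i, f.ofConv (matCoef ρ x i) = algebraMap k B (y i)

variable {B : Type*} [CommRing B] [Algebra k B] {x y z : Fin n → k}

theorem matCoef_eq_sum (ρ : (Fin n → k) →ₗ[k] (Fin n → k) ⊗[k] R) (v : Fin n → k) (i : Fin n) :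
    matCoef ρ v i = ∑ j, v j • matCoef ρ (Pi.single j 1) i := by
  unfold matCoef
  conv_lhs => rw [pi_eq_sum_univ' v]
  simp only [map_sum, map_smul]

theorem mul_apply_matCoef (hρ : IsCoaction ρ) (f : WithConv (R →ₐ[k] B))
    {g : WithConv (R →ₐ[k] B)} (hg : Carries ρ x y g) (i : Fin n) :
    (f * g).ofConv (matCoef ρ x i) = f.ofConv (matCoef ρ y i) := by
  rw [AlgHom.convMul_apply, comul_matCoef hρ, matCoef_eq_sum ρ y]
  simp [hg _, Algebra.smul_def, mul_comm]

theorem Carries.mul (hρ : IsCoaction ρ) {f g : WithConv (R →ₐ[k] B)} (hf : Carries ρ y z f)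
    (hg : Carries ρ x y g) : Carries ρ x z (f * g) := fun i => by
  rw [mul_apply_matCoef hρ f hg, hf i]

theorem Carries.pointInv (hρ : IsCoaction ρ) {f : WithConv (R →ₐ[k] B)} (hf : Carries ρ x y f) :
    Carries ρ y x (pointInv f) := fun i => by
  rw [← mul_apply_matCoef hρ _ hf, pointInv_mul, AlgHom.convOne_apply, counit_matCoef hρ]

theorem Carries.comp {C : Type*} [CommRing C] [Algebra k C] {f : WithConv (R →ₐ[k] B)}
    (hf : Carries ρ x y f) (φ : B →ₐ[k] C) : Carries ρ x y (toConv (φ.comp f.ofConv)) := fun i => by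
  simp [hf i]

/-- The ideal of the closed subscheme of `G = Spec R` of those `g` with `g • x = y`. -/
noncomputable def transporterIdeal (ρ : (Fin n → k) →ₗ[k] (Fin n → k) ⊗[k] R)
    (x y : Fin n → k) : Ideal R :=
  Ideal.span {r | ∃ i, r = matCoef ρ x i - algebraMap k R (y i)}

theorem carries_mk (ρ : (Fin n → k) →ₗ[k] (Fin n → k) ⊗[k] R) (x y : Fin n → k) :
    Carries ρ x y (toConv (Ideal.Quotient.mkₐ k (transporterIdeal ρ x y))) := fun i => by
  rw [ofConv_toConv, ← AlgHom.commutes (Ideal.Quotient.mkₐ k (transporterIdeal ρ x y))]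
  exact Ideal.Quotient.eq.2 (Ideal.subset_span ⟨i, rfl⟩)

theorem Carries.transporterIdeal_le {f : WithConv (R →ₐ[k] B)} (hf : Carries ρ x y f) :
    transporterIdeal ρ x y ≤ RingHom.ker f.ofConv := by
  rw [transporterIdeal, Ideal.span_le]
  rintro _ ⟨i, rfl⟩
  simp [RingHom.mem_ker, hf i]

theorem Carries.exists_comp_mk_eq {f : WithConv (R →ₐ[k] B)} (hf : Carries ρ x y f) :
    ∃ φ : R ⧸ transporterIdeal ρ x y →ₐ[k] B,
      φ.comp (Ideal.Quotient.mkₐ k (transporterIdeal ρ x y)) = f.ofConv :=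
  ⟨Ideal.Quotient.liftₐ _ f.ofConv fun _ hr => hf.transporterIdeal_le hr,
    Ideal.Quotient.liftₐ_comp _ _ _⟩

/-- A nonempty transporter is smooth if the stabilizer is, being a torsor under it. -/
theorem smooth_transporter [Algebra.FiniteType k R] (hρ : IsCoaction ρ) (x y : Fin n → k)
    [Algebra.FormallySmooth k (R ⧸ transporterIdeal ρ x x)]
    [Nontrivial (R ⧸ transporterIdeal ρ x y)] :
    Algebra.Smooth k (R ⧸ transporterIdeal ρ x y) := by
  have : Algebra.FinitePresentation k (R ⧸ transporterIdeal ρ x y) :=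
    Algebra.FinitePresentation.of_finiteType.1 inferInstance
  set A := R ⧸ transporterIdeal ρ x y with hA
  let mk : R →ₐ[k] A := Ideal.Quotient.mkₐ k (transporterIdeal ρ x y)
  have hmk : Carries ρ x y (toConv mk) := carries_mk ρ x y
  have : Algebra.FormallySmooth A (A ⊗[k] A) := by
    refine Algebra.FormallySmooth.of_comp_surjective fun B _ _ I hI t => ?_
    let _ : Algebra k B := ((algebraMap A B).comp (algebraMap k A)).toAlgebra
    have : IsScalarTower k A B := .of_algebraMap_eq' rfl
    let g : WithConv (R →ₐ[k] B) := toConv ((IsScalarTower.toAlgHom k A B).comp mk)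
    have hg : Carries ρ x y g := hmk.comp _
    let q : B →ₐ[k] B ⧸ I := Ideal.Quotient.mkₐ k I
    let gq : WithConv (R →ₐ[k] B ⧸ I) := toConv (q.comp g.ofConv)
    have hgq : Carries ρ x y gq := hg.comp q
    let tr : A →ₐ[k] B ⧸ I := (t.restrictScalars k).comp Algebra.TensorProduct.includeRight
    let h : WithConv (R →ₐ[k] B ⧸ I) := toConv (tr.comp mk)
    have hh : Carries ρ x y h := hmk.comp tr
    obtain ⟨s, hs⟩ := ((hgq.pointInv hρ).mul hρ hh).exists_comp_mk_eq
    obtain ⟨s', hs'⟩ := Algebra.FormallySmooth.comp_surjective k _ I hI s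
    have hl : Carries ρ x y (g * toConv (s'.comp (Ideal.Quotient.mkₐ k (transporterIdeal ρ x x)))) :=
      hg.mul hρ ((carries_mk ρ x x).comp s')
    obtain ⟨l, hl⟩ := hl.exists_comp_mk_eq
    refine ⟨Algebra.TensorProduct.lift (Algebra.ofId A B) l fun _ _ => .all _ _, ?_⟩
    have key : q.comp l = tr := by
      rw [← AlgHom.cancel_right (Ideal.Quotient.mkₐ_surjective k (transporterIdeal ρ x y)),
        AlgHom.comp_assoc, hl, AlgHom.comp_convMul_distrib]
      have : q.comp (toConv (s'.comp (Ideal.Quotient.mkₐ k (transporterIdeal ρ x x)))).ofConv =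
          (pointInv gq * h).ofConv := by
        rw [← hs, ← hs']
        rfl
      rw [this]
      change (gq * (pointInv gq * h)).ofConv = _
      rw [← mul_assoc, mul_pointInv, one_mul]
    ext a
    exact (congrArg q (by simp)).trans (DFunLike.congr_fun key a)
  have : Algebra.Smooth A (A ⊗[k] A) := ⟨inferInstance, inferInstance⟩
  exact Algebra.Smooth.of_smooth_tensorProduct_of_faithfullyFlat A

theorem ptAct_apply (ρ : (Fin n → k) →ₗ[k] (Fin n → k) ⊗[k] R) (g : R →ₐ[k] k) (v : Fin n → k)
    (i : Fin n) : ptAct ρ g v i = g (matCoef ρ v i) := by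
  rw [ptAct, eq_sum_tmul_matCoef ρ v]
  simp [Finset.sum_apply, Pi.single_apply]

theorem nontrivial_transporter (w x : Fin n → k)
    (hx : ratPoint x ∈ Set.range (orbitMap ρ w).base) :
    Nontrivial (R ⧸ transporterIdeal ρ w x) := by
  obtain ⟨p, hp⟩ := hx
  rw [Ideal.Quotient.nontrivial_iff]
  refine ne_top_of_le_ne_top p.isPrime.ne_top ?_
  rw [transporterIdeal, Ideal.span_le]
  rintro _ ⟨i, rfl⟩
  have h : MvPolynomial.X i - MvPolynomial.C (x i) ∈ (ratPoint x).asIdeal := by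
    simp [ratPoint, RingHom.mem_ker]
  rw [← hp] at h
  replace h : orbitHom ρ w (MvPolynomial.X i - MvPolynomial.C (x i)) ∈ p.asIdeal := h
  simpa [orbitHom] using h

end Transporter

theorem semistable_points_single_orbit
    (k : Type) [Field k] [IsSepClosed k] (R : Type) [CommRing R] [HopfAlgebra k R]
    (hG : IsReductive k R)
    (n : ℕ) (ρ : (Fin n → k) →ₗ[k] (Fin n → k) ⊗[k] R) (hρ : IsCoaction ρ)
    -- the representation `V` is irreducible:
    (hirr : ∀ W : Submodule k (Fin n → k),
      (∀ v ∈ W, ρ v ∈ LinearMap.range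
        (TensorProduct.map W.subtype (LinearMap.id : R →ₗ[k] R))) → W = ⊥ ∨ W = ⊤)
    (w : Fin n → k)
    (hU : IsOpen (Set.range (orbitMap ρ w).base))
    (S : Type) [CommRing S] [HopfAlgebra k S] (π : R →ₐ[k] S)
    (hπ : IsHopfQuotient π) (hker : RingHom.ker π.toRingHom = stabIdeal ρ w)
    (hstab : IsReductive k S)
    -- `Δ` is a nonconstant relative invariant with character `χ`:
    (Δ : MvPolynomial (Fin n) k) (hΔ : Δ.totalDegree ≠ 0)
    (χ : R) (hrel : coactPoly ρ Δ = Δ ⊗ₜ[k] χ)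
    -- regularity: the complement of the open orbit is the zero set of `Δ`, i.e. `U = V^ss`:
    (hreg : Set.range (orbitMap ρ w).base = (PrimeSpectrum.zeroLocus {Δ})ᶜ) :
    ∀ x y : Fin n → k, MvPolynomial.eval x Δ ≠ 0 → MvPolynomial.eval y Δ ≠ 0 →
      ∃ g : R →ₐ[k] k, ptAct ρ g x = y := by
  obtain ⟨_, _, -⟩ := hG
  obtain ⟨-, _, -⟩ := hstab
  have e : (R ⧸ transporterIdeal ρ w w) ≃ₐ[k] S :=
    (Ideal.quotientEquivAlgOfEq k hker.symm).trans
      (Ideal.quotientKerAlgEquivOfSurjective hπ.1)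
  have : Algebra.FormallySmooth k (R ⧸ transporterIdeal ρ w w) := .of_equiv e.symm
  have key (x : Fin n → k) (hx : MvPolynomial.eval x Δ ≠ 0) :
      ∃ g : WithConv (R →ₐ[k] k), Carries ρ w x g := by
    have : Nontrivial (R ⧸ transporterIdeal ρ w x) := by
      refine nontrivial_transporter w x ?_
      rw [hreg]
      exact fun h => hx (h (Set.mem_singleton Δ))
    have := smooth_transporter hρ w x
    obtain ⟨φ⟩ := nonempty_algHom_of_smooth k (R ⧸ transporterIdeal ρ w x)
    exact ⟨_, (carries_mk ρ w x).comp φ⟩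
  intro x y hx hy
  obtain ⟨g, hg⟩ := key x hx
  obtain ⟨h, hh⟩ := key y hy
  refine ⟨(h * pointInv g).ofConv, funext fun i => ?_⟩
  rw [ptAct_apply]
  exact hh.mul hρ (hg.pointInv hρ) i
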